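/- Fix 1 ≤ k ≤ n and let A ∈ M_n(ℂ) satisfy: a_{ij} = 0 whenever i ≤ k and (j < i or j > k); a_{ii} ≠ 0 for 1 ≤ i ≤ k; and a_{ij} = 0 for all i > k and all j (so e_i·e_i = ∑_{j=i}^{k} a_{ij} e_j with a_{ii} ≠ 0 for i ≤ k, and e_i·e_i = 0 for i > k). Then every derivation d of E(A) satisfies d(e_i) = 0 for all 1 ≤ i ≤ k, and d(e_i) lies in the span of e_{k+1},…,e_n for all k+1 ≤ i ≤ n; that is, the matrix of d has the block form with zero upper-left k×k, zero upper-right, zero lower-left blocks and an arbitrary (n−k)×(n−k) lower-right block D. -/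

import Mathlib

open Matrix Polynomial Finset

/-- The multiplication of the evolution algebra `E(A)` on `ℂ^n` associated to the
matrix `A`: it is the unique commutative bilinear multiplication with
`e i · e j = 0` for `i ≠ j` and `e i · e i = ∑ k, A i k • e k`, where `e i = Pi.single i 1`
is the standard (natural) basis. -/
noncomputable def evolMul {n : ℕ} (A : Matrix (Fin n) (Fin n) ℂ) (u v : Fin n → ℂ) : Fin n → ℂ :=
  fun k => ∑ i, u i * v i * A i k

/-- A linear map `d : E(A) → E(A)` is a derivation if `d (u·v) = d u · v + u · d v`. -/
def IsEvolDerivation {n : ℕ} (A : Matrix (Fin n) (Fin n) ℂ)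
    (d : (Fin n → ℂ) →ₗ[ℂ] (Fin n → ℂ)) : Prop :=
  ∀ u v : Fin n → ℂ, d (evolMul A u v) = evolMul A (d u) v + evolMul A u (d v)

theorem evolMul_single_right {n : ℕ} (A : Matrix (Fin n) (Fin n) ℂ) (u : Fin n → ℂ) (j l : Fin n) :
    evolMul A u (Pi.single j 1) l = u j * A j l := by
  simp [evolMul, Pi.single_apply]

theorem evolMul_single_left {n : ℕ} (A : Matrix (Fin n) (Fin n) ℂ) (u : Fin n → ℂ) (j l : Fin n) :
    evolMul A (Pi.single j 1) u l = u j * A j l := by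
  simp [evolMul, Pi.single_apply]

theorem evolMul_single_self {n : ℕ} (A : Matrix (Fin n) (Fin n) ℂ) (i : Fin n) :
    evolMul A (Pi.single i 1) (Pi.single i 1) = ∑ j, A i j • (Pi.single j 1 : Fin n → ℂ) := by
  ext l
  simp [evolMul_single_right, Pi.single_apply]

theorem evolMul_single_single_of_ne {n : ℕ} (A : Matrix (Fin n) (Fin n) ℂ) {i j : Fin n}
    (h : i ≠ j) : evolMul A (Pi.single i 1) (Pi.single j 1) = 0 := by
  ext l
  simp [evolMul_single_right, h.symm]

/-- The coordinates of the derivation rule at two distinct natural basis vectors. -/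
theorem IsEvolDerivation.apply_single_of_ne {n : ℕ} {A : Matrix (Fin n) (Fin n) ℂ}
    {d : (Fin n → ℂ) →ₗ[ℂ] (Fin n → ℂ)} (hd : IsEvolDerivation A d) {i j : Fin n} (h : i ≠ j)
    (l : Fin n) : d (Pi.single i 1) j * A j l + d (Pi.single j 1) i * A i l = 0 := by
  have key := congrFun (hd (Pi.single i 1) (Pi.single j 1)) l
  rw [evolMul_single_single_of_ne A h, map_zero, Pi.add_apply, evolMul_single_right,
    evolMul_single_left] at key
  exact key.symm

/-- The coordinates of the derivation rule at the square of a natural basis vector. -/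
theorem IsEvolDerivation.apply_single_self {n : ℕ} {A : Matrix (Fin n) (Fin n) ℂ}
    {d : (Fin n → ℂ) →ₗ[ℂ] (Fin n → ℂ)} (hd : IsEvolDerivation A d) (i l : Fin n) :
    ∑ j, A i j * d (Pi.single j 1) l = 2 * d (Pi.single i 1) i * A i l := by
  have key := congrFun (hd (Pi.single i 1) (Pi.single i 1)) l
  rw [evolMul_single_self, map_sum, Pi.add_apply, evolMul_single_right,
    evolMul_single_left] at key
  simp only [map_smul, Finset.sum_apply, Pi.smul_apply, smul_eq_mul] at key
  rw [key]
  ring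

/-- Let `1 ≤ k ≤ n` and suppose `A` is such that `eᵢ·eᵢ = ∑_{j=i}^{k} aᵢⱼ eⱼ` with
`aᵢᵢ ≠ 0` for `1 ≤ i ≤ k`, while `eᵢ·eᵢ = 0` for `k+1 ≤ i ≤ n`.  Then every derivation
`d` of `E(A)` satisfies `d(eᵢ) = 0` for `1 ≤ i ≤ k` and `d(eᵢ) ∈ span{e_{k+1},…,eₙ}`
for `k+1 ≤ i ≤ n`; i.e. the matrix of `d` is zero except for the lower-right
`(n-k) × (n-k)` block. -/
theorem derivation_block_form (n k : ℕ) (hk1 : 1 ≤ k) (hkn : k ≤ n)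
    (A : Matrix (Fin n) (Fin n) ℂ)
    (hA0 : ∀ i j : Fin n, i.val < k → (j.val < i.val ∨ k ≤ j.val) → A i j = 0)
    (hAd : ∀ i : Fin n, i.val < k → A i i ≠ 0)
    (hAz : ∀ i : Fin n, k ≤ i.val → A i = 0)
    (d : (Fin n → ℂ) →ₗ[ℂ] (Fin n → ℂ)) (hd : IsEvolDerivation A d) :
    (∀ i : Fin n, i.val < k → d (Pi.single i 1) = 0) ∧
      (∀ i : Fin n, k ≤ i.val →
        d (Pi.single i 1) ∈ Submodule.span ℂ
          {v : Fin n → ℂ | ∃ j : Fin n, k ≤ j.val ∧ v = Pi.single j 1}) := by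
  have high_low : ∀ i j : Fin n, k ≤ i.val → j.val < k → d (Pi.single i 1) j = 0 := by
    intro i j hi hj
    have hij : i ≠ j := by rintro rfl; omega
    have h := hd.apply_single_of_ne hij j
    simpa [hAz i hi, hAd j hj] using h
  have low_low_lt : ∀ i j : Fin n, i < j → j.val < k →
      d (Pi.single i 1) j = 0 ∧ d (Pi.single j 1) i = 0 := by
    intro i j hij hj
    have hi : i.val < k := lt_trans hij hj
    have hji : d (Pi.single j 1) i = 0 := by
      have h := hd.apply_single_of_ne hij.ne i
      simpa [hA0 j i hj (Or.inl hij), hAd i hi] using h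
    have h := hd.apply_single_of_ne hij.ne j
    exact ⟨by simpa [hji, hAd j hj] using h, hji⟩
  have off_diag : ∀ i j : Fin n, i ≠ j → j.val < k → d (Pi.single i 1) j = 0 := by
    intro i j hij hj
    rcases lt_or_ge i.val k with hi | hi
    · rcases lt_or_gt_of_ne hij with h | h
      · exact (low_low_lt i j h hj).1
      · exact (low_low_lt j i h hi).2
    · exact high_low i j hi hj
  have diag : ∀ i : Fin n, i.val < k → d (Pi.single i 1) i = 0 := by
    intro i hi
    have h := hd.apply_single_self i i
    rw [Finset.sum_eq_single i (fun j _ hj => by rw [off_diag j i hj hi, mul_zero])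
      (by simp)] at h
    have h' : A i i * d (Pi.single i 1) i = 0 := by linear_combination -h
    exact (mul_eq_zero.mp h').resolve_left (hAd i hi)
  refine ⟨fun i => ?_, fun i hi => ?_⟩
  · induction i using WellFoundedGT.induction with
    | ind i ih =>
      intro hi
      ext l
      have h := hd.apply_single_self i l
      rw [diag i hi, Finset.sum_eq_single i (fun j _ hj => ?_) (by simp)] at h
      · simpa [hAd i hi] using h
      · rcases lt_or_gt_of_ne hj with hji | hij
        · rw [hA0 i j hi (Or.inl hji), zero_mul]
        · rcases lt_or_ge j.val k with hjk | hjk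
          · rw [ih j hij hjk, Pi.zero_apply, mul_zero]
          · rw [hA0 i j hi (Or.inr hjk), zero_mul]
  · rw [pi_eq_sum_univ' (d (Pi.single i 1))]
    refine Submodule.sum_mem _ fun j _ => ?_
    rcases lt_or_ge j.val k with hj | hj
    · rw [high_low i j hi hj, zero_smul]
      exact Submodule.zero_mem _
    · refine Submodule.smul_mem _ _ (Submodule.subset_span ⟨j, hj, ?_⟩)
      ext l
      simp [Pi.single_apply, eq_comm]
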